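/- arXiv:2007.16042 — 5 statements merged into one kernel-verified Lean document; each statement's English description precedes it below -/
import Mathlib

section
/- Let u and v be vertices of the Johnson graph J(m,k). Then the graph distance between u and v equals |u △ v| / 2, where △ denotes symmetric difference. -/
open SimpleGraph

/-- The Johnson graph `J(m,k)`. -/
def johnsonGraph (m k : ℕ) : SimpleGraph {s : Finset (Fin m) // s.card = k} where
  Adj u v := (symmDiff u.1 v.1).card = 2
  symm := by
    refine ⟨?_⟩
    intro u v h
    rwa [symmDiff_comm]
  loopless := by
    refine ⟨?_⟩
    intro u h
    simp [symmDiff_self, Finset.bot_eq_empty] at h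

theorem johnson_card_symm {m k : ℕ} (u v : {s : Finset (Fin m) // s.card = k}) :
    (symmDiff u.1 v.1).card = 2 * (u.1 \ v.1).card := by
  have h1 : (symmDiff u.1 v.1).card = (u.1 \ v.1).card + (v.1 \ u.1).card := by
    rw [symmDiff_def, Finset.sup_eq_union, Finset.card_union_of_disjoint disjoint_sdiff_sdiff]
  have h2 : (u.1 \ v.1).card = (v.1 \ u.1).card :=
    Finset.card_sdiff_comm (u.2.trans v.2.symm)
  omega

theorem johnson_walk_lower {m k : ℕ} {u v : {s : Finset (Fin m) // s.card = k}}
    (p : (johnsonGraph m k).Walk u v) : (u.1 \ v.1).card ≤ p.length := by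
  induction p with
  | nil => simp
  | @cons a b c h p ih =>
    have h' : (symmDiff a.1 b.1).card = 2 := h
    rw [johnson_card_symm] at h'
    have h3 : (a.1 \ c.1).card ≤ (a.1 \ b.1).card + (b.1 \ c.1).card := by
      refine le_trans (Finset.card_le_card ?_) (Finset.card_union_le _ _)
      intro x
      simp only [Finset.mem_sdiff, Finset.mem_union]
      tauto
    rw [SimpleGraph.Walk.length_cons]
    omega

theorem johnson_walk_exists {m k : ℕ} (n : ℕ) :
    ∀ u v : {s : Finset (Fin m) // s.card = k}, (u.1 \ v.1).card = n →
      ∃ p : (johnsonGraph m k).Walk u v, p.length = n := by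
  induction n with
  | zero =>
    intro u v h
    have hs : u.1 ⊆ v.1 := by simpa using h
    have he : u = v := Subtype.ext (Finset.eq_of_subset_of_card_le hs (by rw [u.2, v.2]))
    subst he
    exact ⟨SimpleGraph.Walk.nil, rfl⟩
  | succ n ih =>
    intro u v h
    have h2 : (u.1 \ v.1).card = (v.1 \ u.1).card :=
      Finset.card_sdiff_comm (u.2.trans v.2.symm)
    obtain ⟨a, ha⟩ : (u.1 \ v.1).Nonempty := Finset.card_pos.mp (by omega)
    obtain ⟨b, hb⟩ : (v.1 \ u.1).Nonempty := Finset.card_pos.mp (by omega)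
    have ha' := Finset.mem_sdiff.mp ha
    have hb' := Finset.mem_sdiff.mp hb
    have hab : a ≠ b := fun e => hb'.2 (e ▸ ha'.1)
    have hwc : (insert b (u.1.erase a)).card = k := by
      rw [Finset.card_insert_of_notMem (by simp [hb'.2]), Finset.card_erase_add_one ha'.1, u.2]
    let w : {s : Finset (Fin m) // s.card = k} := ⟨insert b (u.1.erase a), hwc⟩
    have huw : u.1 \ w.1 = {a} := by
      ext x
      simp only [w, Finset.mem_sdiff, Finset.mem_insert, Finset.mem_erase, Finset.mem_singleton]
      grind
    have hwv : w.1 \ v.1 = (u.1 \ v.1).erase a := by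
      ext x
      simp only [w, Finset.mem_sdiff, Finset.mem_insert, Finset.mem_erase]
      grind
    have hadj : (johnsonGraph m k).Adj u w := by
      change (symmDiff u.1 w.1).card = 2
      rw [johnson_card_symm, huw, Finset.card_singleton]
    obtain ⟨p, hp⟩ := ih w v (by rw [hwv, Finset.card_erase_of_mem ha, h]; rfl)
    exact ⟨SimpleGraph.Walk.cons hadj p, by rw [SimpleGraph.Walk.length_cons, hp]⟩

/-- The graph distance in the Johnson graph is half the size of the symmetric difference. -/
theorem johnson_dist (m k : ℕ) (hk : k ≤ m) (u v : {s : Finset (Fin m) // s.card = k}) :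
    (johnsonGraph m k).dist u v = (symmDiff u.1 v.1).card / 2 := by
  obtain ⟨p, hp⟩ := johnson_walk_exists _ u v rfl
  have h1 := SimpleGraph.dist_le p
  obtain ⟨q, hq⟩ := p.reachable.exists_walk_length_eq_dist
  have h2 := johnson_walk_lower q
  rw [johnson_card_symm]
  omega
end

section
/- Let v be a vertex in the Johnson graph J(m,k). Then the subgraph of J(m,k) induced by the open neighbourhood N(v) is isomorphic to the rook's graph R(k, m−k). -/
open SimpleGraph

/-- The rook's graph `R(m,n)`. -/
def rooksGraph (m n : ℕ) : SimpleGraph (Fin m × Fin n) where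
  Adj u v := u ≠ v ∧ (u.1 = v.1 ∨ u.2 = v.2)
  symm := by
    refine ⟨?_⟩
    rintro u v ⟨h1, h2⟩
    exact ⟨h1.symm, h2.imp Eq.symm Eq.symm⟩
  loopless := by
    refine ⟨?_⟩
    rintro u ⟨h1, _⟩
    exact h1 rfl

theorem jn_pair_card {α : Type*} [DecidableEq α] (a b a' b' : α) (h1 : a ≠ b) (h2 : a ≠ b')
    (h3 : a' ≠ b) (h4 : a' ≠ b') :
    (symmDiff ({a, b} : Finset α) {a', b'}).card = 2 ↔
      (¬ (a = a' ∧ b = b') ∧ (a = a' ∨ b = b')) := by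
  by_cases ha : a = a'
  · subst ha
    by_cases hb : b = b'
    · subst hb
      simp
    · have : symmDiff ({a, b} : Finset α) {a, b'} = {b, b'} := by
        ext x; simp only [Finset.mem_symmDiff, Finset.mem_insert, Finset.mem_singleton]; grind
      rw [this, Finset.card_pair hb]; simp [hb]
  · by_cases hb : b = b'
    · subst hb
      have : symmDiff ({a, b} : Finset α) {a', b} = {a, a'} := by
        ext x; simp only [Finset.mem_symmDiff, Finset.mem_insert, Finset.mem_singleton]; grind
      rw [this, Finset.card_pair ha]; simp [ha]
    · have : symmDiff ({a, b} : Finset α) {a', b'} = {a, b, a', b'} := by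
        ext x; simp only [Finset.mem_symmDiff, Finset.mem_insert, Finset.mem_singleton]; grind
      have hc : ({a, b, a', b'} : Finset α).card = 4 := by
        rw [Finset.card_insert_of_notMem (by simp [*]),
          Finset.card_insert_of_notMem (by simp [*, Ne.symm h3]), Finset.card_pair h4]
      rw [this, hc]; simp [ha, hb]

theorem jn_swap_card {α : Type*} [DecidableEq α] (v : Finset α) (a b : α) (ha : a ∈ v)
    (hb : b ∉ v) : (symmDiff v {a, b}).card = v.card := by
  have : symmDiff v {a, b} = insert b (v.erase a) := by
    ext x
    simp only [Finset.mem_symmDiff, Finset.mem_insert, Finset.mem_singleton, Finset.mem_erase]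
    grind
  rw [this, Finset.card_insert_of_notMem (by simp [hb]), Finset.card_erase_add_one ha]

theorem jn_surj {α : Type*} [DecidableEq α] (v u : Finset α) (h : u.card = v.card)
    (h2 : (symmDiff v u).card = 2) : ∃ a ∈ v, ∃ b ∉ v, symmDiff v {a, b} = u := by
  have e : (v \ u).card = (u \ v).card := Finset.card_sdiff_comm h.symm
  have hs : (v \ u).card + (u \ v).card = 2 := by
    rw [← h2, symmDiff_def, Finset.sup_eq_union, Finset.card_union_of_disjoint]
    exact disjoint_sdiff_sdiff
  obtain ⟨a, ha⟩ := Finset.card_eq_one.1 (show (v \ u).card = 1 by omega)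
  obtain ⟨b, hb⟩ := Finset.card_eq_one.1 (show (u \ v).card = 1 by omega)
  have ha' : a ∈ v \ u := by simp [ha]
  have hb' : b ∈ u \ v := by simp [hb]
  refine ⟨a, (Finset.mem_sdiff.1 ha').1, b, (Finset.mem_sdiff.1 hb').2, ?_⟩
  have : ({a, b} : Finset α) = symmDiff v u := by
    rw [symmDiff_def, ha, hb]; rfl
  rw [this, symmDiff_symmDiff_cancel_left]

/-- The neighbourhood of a vertex of the Johnson graph `J(m,k)` induces the
rook's graph `R(k, m-k)`. -/
theorem johnson_neighborhood_iso_rook (m k : ℕ) (hk : k ≤ m)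
    (v : {s : Finset (Fin m) // s.card = k}) :
    Nonempty (((johnsonGraph m k).induce ((johnsonGraph m k).neighborSet v)) ≃g
      rooksGraph k (m - k)) := by
  classical
  obtain ⟨v, hv⟩ := v
  have c1 : Fintype.card {x // x ∈ v} = k := by simp [hv]
  have c2 : Fintype.card {x // x ∉ v} = m - k := by
    rw [Fintype.card_subtype_compl]; simp [hv]
  let e1 := Fintype.equivFinOfCardEq c1
  let e2 := Fintype.equivFinOfCardEq c2
  let f : {x // x ∈ v} × {x // x ∉ v} → (johnsonGraph m k).neighborSet ⟨v, hv⟩ := fun p =>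
    ⟨⟨symmDiff v {p.1.1, p.2.1}, (jn_swap_card v _ _ p.1.2 p.2.2).trans hv⟩, by
      change (symmDiff v (symmDiff v {p.1.1, p.2.1})).card = 2
      rw [symmDiff_symmDiff_cancel_left]
      exact Finset.card_pair (fun h => p.2.2 (h ▸ p.1.2))⟩
  have ne : ∀ (x : {x // x ∈ v}) (y : {x // x ∉ v}), x.1 ≠ y.1 :=
    fun x y h => y.2 (h ▸ x.2)
  have finj : Function.Injective f := by
    intro p q h
    have h' : symmDiff v {p.1.1, p.2.1} = symmDiff v {q.1.1, q.2.1} :=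
      congrArg (fun z => z.1.1) h
    have h'' := symmDiff_right_injective v h'
    have n1 := ne p.1 q.2
    have n2 := ne q.1 p.2
    have m1 : p.1.1 ∈ ({q.1.1, q.2.1} : Finset (Fin m)) := by rw [← h'']; simp
    have m2 : p.2.1 ∈ ({q.1.1, q.2.1} : Finset (Fin m)) := by rw [← h'']; simp
    simp only [Finset.mem_insert, Finset.mem_singleton] at m1 m2
    refine Prod.ext (Subtype.ext ?_) (Subtype.ext ?_)
    · exact m1.resolve_right n1
    · exact m2.resolve_left n2.symm
  have fsurj : Function.Surjective f := by
    rintro ⟨⟨u, hu⟩, h⟩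
    obtain ⟨a, ha, b, hb, hab⟩ := jn_surj v u (hu.trans hv.symm) h
    exact ⟨(⟨a, ha⟩, ⟨b, hb⟩), Subtype.ext (Subtype.ext hab)⟩
  let F := Equiv.ofBijective f ⟨finj, fsurj⟩
  let E : Fin k × Fin (m - k) ≃ (johnsonGraph m k).neighborSet ⟨v, hv⟩ :=
    (Equiv.prodCongr e1 e2).symm.trans F
  refine ⟨(RelIso.symm ⟨E, ?_⟩)⟩
  rintro ⟨i, j⟩ ⟨i', j'⟩
  change (symmDiff (symmDiff v {(e1.symm i).1, (e2.symm j).1})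
    (symmDiff v {(e1.symm i').1, (e2.symm j').1})).card = 2 ↔
    ((i, j) ≠ (i', j') ∧ (i = i' ∨ j = j'))
  rw [symmDiff_comm v, symmDiff_assoc, symmDiff_symmDiff_cancel_left,
    jn_pair_card _ _ _ _ (ne _ _) (ne _ _) (ne _ _) (ne _ _)]
  simp only [Subtype.val_inj, EmbeddingLike.apply_eq_iff_eq, ne_eq, Prod.mk.injEq]
end

section
/- Let A be a set of vertices in a Johnson graph J(m,k) that is shattered by the edge relation, and assume |A| ≥ 4. Then A does not contain three vertices that are pairwise at graph distance 2 from each other. -/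
open SimpleGraph

/-- `A` is shattered by the (open) neighbourhoods of `G`. -/
def edgeShatters {V : Type*} (G : SimpleGraph V) (A : Set V) : Prop :=
  ∀ B ⊆ A, ∃ w, A ∩ G.neighborSet w = B


lemma card_sd {α : Type*} [DecidableEq α] (s t : Finset α) :
    (symmDiff s t).card + 2 * (s ∩ t).card = s.card + t.card := by
  have h1 : (symmDiff s t).card = (s \ t).card + (t \ s).card := by
    have : symmDiff s t = (s \ t) ∪ (t \ s) := rfl
    rw [this, Finset.card_union_of_disjoint disjoint_sdiff_sdiff]
  have h2 := Finset.card_sdiff_add_card_inter s t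
  have h3 := Finset.card_sdiff_add_card_inter t s
  rw [Finset.inter_comm t s] at h3
  omega

lemma sd_disj {α : Type*} [DecidableEq α] (a b x : Finset α) (ha : (symmDiff x a).card = 2)
    (hb : (symmDiff x b).card = 2) (hne : a ≠ b) (h2 : (symmDiff a b).card ≠ 2) :
    Disjoint (symmDiff x a) (symmDiff x b) := by
  have h := card_sd (symmDiff x a) (symmDiff x b)
  have e : symmDiff (symmDiff x a) (symmDiff x b) = symmDiff a b := by
    rw [symmDiff_comm x a, symmDiff_assoc, symmDiff_symmDiff_cancel_left]
  rw [e] at h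
  have h0 : (symmDiff a b).card ≠ 0 := by
    intro h0
    rw [Finset.card_eq_zero] at h0
    exact hne (symmDiff_eq_bot.1 h0)
  rw [Finset.disjoint_iff_inter_eq_empty, ← Finset.card_eq_zero]
  omega

lemma sd_half {α : Type*} [DecidableEq α] (a x y : Finset α) (ha : (symmDiff x a).card = 2)
    (hb : (symmDiff y a).card = 2) :
    (symmDiff x y).card = 2 * (symmDiff x y ∩ symmDiff x a).card := by
  have h := card_sd (symmDiff x y) (symmDiff x a)
  have e : symmDiff (symmDiff x y) (symmDiff x a) = symmDiff y a := by
    rw [symmDiff_comm x y, symmDiff_assoc, symmDiff_symmDiff_cancel_left]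
  rw [e] at h
  omega

lemma sd_unique {α : Type*} [DecidableEq α] (a b c x y : Finset α)
    (hxa : (symmDiff x a).card = 2) (hxb : (symmDiff x b).card = 2)
    (hxc : (symmDiff x c).card = 2)
    (hya : (symmDiff y a).card = 2) (hyb : (symmDiff y b).card = 2)
    (hyc : (symmDiff y c).card = 2)
    (hab : a ≠ b) (hac : a ≠ c) (hbc : b ≠ c)
    (h1 : (symmDiff a b).card ≠ 2) (h2 : (symmDiff a c).card ≠ 2)
    (h3 : (symmDiff b c).card ≠ 2) : x = y := by
  have d1 := sd_disj a b x hxa hxb hab h1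
  have d2 := sd_disj a c x hxa hxc hac h2
  have d3 := sd_disj b c x hxb hxc hbc h3
  have e1 := sd_half a x y hxa hya
  have e2 := sd_half b x y hxb hyb
  have e3 := sd_half c x y hxc hyc
  generalize symmDiff x a = p at *
  generalize symmDiff x b = q at *
  generalize symmDiff x c = r at *
  have hX : symmDiff x y = ⊥ → x = y := symmDiff_eq_bot.1
  generalize symmDiff x y = X at *
  apply hX
  have hs : (X ∩ p ∪ X ∩ q ∪ X ∩ r).card ≤ X.card := by
    apply Finset.card_le_card
    intro z hz
    simp only [Finset.mem_union, Finset.mem_inter] at hz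
    tauto
  rw [Finset.card_union_of_disjoint, Finset.card_union_of_disjoint] at hs
  · rw [Finset.bot_eq_empty, ← Finset.card_eq_zero]
    omega
  · exact d1.mono Finset.inter_subset_right Finset.inter_subset_right
  · rw [Finset.disjoint_union_left]
    exact ⟨d2.mono Finset.inter_subset_right Finset.inter_subset_right,
      d3.mono Finset.inter_subset_right Finset.inter_subset_right⟩

/-- A shattered set of size at least 4 in a Johnson graph contains no three vertices
pairwise at distance 2. -/
theorem johnson_shattered_no_three_pairwise_dist_two (m k : ℕ) (hk : k ≤ m)
    (A : Set {s : Finset (Fin m) // s.card = k})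
    (hsh : edgeShatters (johnsonGraph m k) A) (hA : 4 ≤ A.ncard) :
    ¬ ∃ u ∈ A, ∃ v ∈ A, ∃ w ∈ A, u ≠ v ∧ u ≠ w ∧ v ≠ w ∧
      (johnsonGraph m k).dist u v = 2 ∧
      (johnsonGraph m k).dist u w = 2 ∧
      (johnsonGraph m k).dist v w = 2 := by
  rintro ⟨u, hu, v, hv, w, hw, huv, huw, hvw, d1, d2, d3⟩
  have key : ∀ p q, (johnsonGraph m k).dist p q = 2 → (symmDiff p.1 q.1).card ≠ 2 := by
    intro p q h h'
    have : (johnsonGraph m k).Adj p q := h'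
    rw [← SimpleGraph.dist_eq_one_iff_adj] at this
    omega
  obtain ⟨d, hd, hdn⟩ : ∃ d ∈ A, d ∉ ({u, v, w} : Set _) := by
    refine Set.exists_mem_notMem_of_ncard_lt_ncard ?_ (Set.toFinite _)
    have := Set.ncard_insert_le u {v, w}
    have := Set.ncard_insert_le v {w}
    have := Set.ncard_singleton w
    omega
  simp only [Set.mem_insert_iff, Set.mem_singleton_iff, not_or] at hdn
  obtain ⟨n1, n2, n3⟩ := hdn
  obtain ⟨x, hx⟩ := hsh A subset_rfl
  obtain ⟨y, hy⟩ := hsh (A \ {d}) Set.sdiff_subset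
  have ax : ∀ z ∈ A, (symmDiff x.1 z.1).card = 2 := fun z hz => by
    rw [← hx] at hz
    exact hz.2
  have ay : ∀ z ∈ A, z ≠ d → (symmDiff y.1 z.1).card = 2 := fun z hz hne => by
    have : z ∈ A \ {d} := ⟨hz, hne⟩
    rw [← hy] at this
    exact this.2
  have hxy : x = y := Subtype.ext <| sd_unique u.1 v.1 w.1 x.1 y.1 (ax u hu) (ax v hv) (ax w hw)
    (ay u hu (Ne.symm n1)) (ay v hv (Ne.symm n2)) (ay w hw (Ne.symm n3))
    (fun h => huv (Subtype.ext h)) (fun h => huw (Subtype.ext h)) (fun h => hvw (Subtype.ext h))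
    (key _ _ d1) (key _ _ d2) (key _ _ d3)
  subst hxy
  rw [hx] at hy
  rw [hy] at hd
  exact hd.2 rfl
end

section
/- Let k ≤ m be natural numbers with m > 2k. Then there exists a set A of vertices of the Johnson graph J(m,k) with |A| = k such that for every 2-element subset {u,v} of A there exists a vertex w of J(m,k) with N(w) ∩ A = {u,v}. Consequently, the number of distinct traces {N(w) ∩ A : w ∈ V(J(m,k))} is at least k(k−1)/2, so the shatter function of the edge relation on the class of Johnson graphs satisfies π(n) ≥ n(n−1)/2 for all n, and the VC-density of the edge relation on the class of Johnson graphs is at least 2. -/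
open SimpleGraph

theorem johnson_aux (m k : ℕ) (hm : 2 * k < m) :
      ∃ A : Finset {s : Finset (Fin m) // s.card = k}, A.card = k ∧
        (∀ u ∈ A, ∀ v ∈ A, u ≠ v →
          ∃ w, (↑A : Set {s : Finset (Fin m) // s.card = k}) ∩
            (johnsonGraph m k).neighborSet w = {u, v}) := by
  classical
  let e : Fin (k - 1) ↪ Fin m := Fin.castLEEmb (by omega)
  let B : Finset (Fin m) := Finset.univ.map e
  have hB : B.card = k - 1 := by simp [B]
  let x : Fin k → Fin m := fun i => ⟨k + i.1, by omega⟩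
  have hx : Function.Injective x := by
    intro i j h
    simp only [x, Fin.mk.injEq] at h
    exact Fin.ext (by omega)
  have hxB : ∀ i, x i ∉ B := by
    intro i h
    simp only [B, Finset.mem_map, Finset.mem_univ, true_and] at h
    obtain ⟨a, ha⟩ := h
    have h2 := congrArg Fin.val ha
    simp only [e, x, Fin.castLEEmb_apply, Fin.val_castLE] at h2
    omega
  have hc : ∀ i, (insert (x i) B).card = k := by
    intro i
    rw [Finset.card_insert_of_notMem (hxB i), hB]
    have := i.2
    omega
  let v : Fin k → {s : Finset (Fin m) // s.card = k} := fun i => ⟨insert (x i) B, hc i⟩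
  have hv : Function.Injective v := by
    intro i j h
    have h1 : insert (x i) B = insert (x j) B := congrArg Subtype.val h
    have h2 : x i ∈ insert (x j) B := h1 ▸ Finset.mem_insert_self _ _
    rcases Finset.mem_insert.1 h2 with h3 | h3
    · exact hx h3
    · exact absurd h3 (hxB i)
  refine ⟨Finset.univ.map ⟨v, hv⟩, by simp, ?_⟩
  intro u hu u' hu' hne
  simp only [Finset.mem_map, Finset.mem_univ, true_and, Function.Embedding.coeFn_mk] at hu hu'
  obtain ⟨i, rfl⟩ := hu
  obtain ⟨j, rfl⟩ := hu'
  have hij : i ≠ j := fun h => hne (by rw [h])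
  have hk : 2 ≤ k := by
    have := i.2
    have := j.2
    have : i.1 ≠ j.1 := fun h => hij (Fin.ext h)
    omega
  have hxij : x i ≠ x j := fun h => hij (hx h)
  obtain ⟨b, hb⟩ : B.Nonempty := by
    rw [← Finset.card_pos]; omega
  have hbx : ∀ l, b ≠ x l := fun l h => hxB l (h ▸ hb)
  have hw : (insert (x i) (insert (x j) (B.erase b))).card = k := by
    rw [Finset.card_insert_of_notMem, Finset.card_insert_of_notMem, Finset.card_erase_of_mem hb, hB]
    · omega
    · simp [hxB]
    · simp [hxB, hxij]
  have h1 : symmDiff (insert (x i) (insert (x j) (B.erase b))) (insert (x i) B) = {b, x j} := by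
    ext y
    have := hxB i
    have := hxB j
    simp only [Finset.mem_symmDiff, Finset.mem_insert, Finset.mem_erase, Finset.mem_singleton]
    grind
  have h2 : symmDiff (insert (x i) (insert (x j) (B.erase b))) (insert (x j) B) = {b, x i} := by
    ext y
    have := hxB i
    have := hxB j
    simp only [Finset.mem_symmDiff, Finset.mem_insert, Finset.mem_erase, Finset.mem_singleton]
    grind
  refine ⟨⟨_, hw⟩, ?_⟩
  ext z
  simp only [Set.mem_inter_iff, Finset.coe_map, Finset.coe_univ, Set.image_univ, Set.mem_range,
    Function.Embedding.coeFn_mk, SimpleGraph.mem_neighborSet, Set.mem_insert_iff,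
    Set.mem_singleton_iff]
  constructor
  · rintro ⟨⟨l, rfl⟩, hl⟩
    by_contra hcon
    push Not at hcon
    have hli : x l ≠ x i := fun h => hcon.1 (by rw [hx h])
    have hlj : x l ≠ x j := fun h => hcon.2 (by rw [hx h])
    change (symmDiff (insert (x i) (insert (x j) (B.erase b))) (insert (x l) B)).card = 2 at hl
    have hsub : ({b, x i, x j} : Finset (Fin m)) ⊆
        symmDiff (insert (x i) (insert (x j) (B.erase b))) (insert (x l) B) := by
      intro y
      have := hxB i
      have := hxB j
      have := hbx i
      have := hbx j
      simp only [Finset.mem_symmDiff, Finset.mem_insert, Finset.mem_erase, Finset.mem_singleton]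
      grind
    have h3 := Finset.card_le_card hsub
    rw [Finset.card_eq_three.2 ⟨b, x i, x j, hbx i, hbx j, hxij, rfl⟩] at h3
    omega
  · rintro (rfl | rfl)
    · refine ⟨⟨i, rfl⟩, ?_⟩
      change (symmDiff (insert (x i) (insert (x j) (B.erase b))) (insert (x i) B)).card = 2
      rw [h1, Finset.card_pair (hbx j)]
    · refine ⟨⟨j, rfl⟩, ?_⟩
      change (symmDiff (insert (x i) (insert (x j) (B.erase b))) (insert (x j) B)).card = 2
      rw [h2, Finset.card_pair (hbx i)]

theorem johnson_aux_count (m k : ℕ) (A : Finset {s : Finset (Fin m) // s.card = k})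
    (hA : A.card = k)
    (h : ∀ u ∈ A, ∀ v ∈ A, u ≠ v →
          ∃ w, (↑A : Set {s : Finset (Fin m) // s.card = k}) ∩
            (johnsonGraph m k).neighborSet w = {u, v}) :
    k * (k - 1) / 2 ≤
          {S : Set {s : Finset (Fin m) // s.card = k} |
            ∃ w, S = (↑A : Set {s : Finset (Fin m) // s.card = k}) ∩
              (johnsonGraph m k).neighborSet w}.ncard := by
  classical
  have h1 : ((fun s : Finset {s : Finset (Fin m) // s.card = k} =>
      (s : Set {s : Finset (Fin m) // s.card = k})) ''
      (↑(A.powersetCard 2) : Set (Finset {s : Finset (Fin m) // s.card = k}))).ncard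
      = k * (k - 1) / 2 := by
    rw [Set.ncard_image_of_injective _ Finset.coe_injective, Set.ncard_coe_finset,
      Finset.card_powersetCard, hA, Nat.choose_two_right]
  rw [← h1]
  apply Set.ncard_le_ncard _ (Set.toFinite _)
  rintro _ ⟨s, hs, rfl⟩
  obtain ⟨hsA, hs2⟩ := Finset.mem_powersetCard.1 (Finset.mem_coe.1 hs)
  obtain ⟨u, v, huv, rfl⟩ := Finset.card_eq_two.1 hs2
  obtain ⟨w, hw⟩ := h u (hsA (by simp)) v (hsA (by simp)) huv
  exact ⟨w, by rw [hw]; simp⟩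

/-- Lower bound witnessing that the VC-density of the edge relation on the class of
Johnson graphs is at least `2`: in `J(m,k)` with `m > 2k` there is a set `A` of `k`
vertices on which every pair is cut out as a trace of a neighbourhood, so there are at
least `k(k-1)/2` traces; consequently the shatter function of the class satisfies
`π(n) ≥ n(n-1)/2` for every `n`. -/
theorem johnson_vc_density_lower :
    (∀ m k : ℕ, k ≤ m → 2 * k < m →
      ∃ A : Finset {s : Finset (Fin m) // s.card = k}, A.card = k ∧
        (∀ u ∈ A, ∀ v ∈ A, u ≠ v →
          ∃ w, (↑A : Set {s : Finset (Fin m) // s.card = k}) ∩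
            (johnsonGraph m k).neighborSet w = {u, v}) ∧
        k * (k - 1) / 2 ≤
          {S : Set {s : Finset (Fin m) // s.card = k} |
            ∃ w, S = (↑A : Set {s : Finset (Fin m) // s.card = k}) ∩
              (johnsonGraph m k).neighborSet w}.ncard) ∧
    (∀ n : ℕ, ∃ m k : ℕ, k ≤ m ∧
      ∃ A : Finset {s : Finset (Fin m) // s.card = k}, A.card = n ∧
        n * (n - 1) / 2 ≤
          {S : Set {s : Finset (Fin m) // s.card = k} |
            ∃ w, S = (↑A : Set {s : Finset (Fin m) // s.card = k}) ∩
              (johnsonGraph m k).neighborSet w}.ncard) := by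
  refine ⟨?_, ?_⟩
  · intro m k _ hm
    obtain ⟨A, hA, h⟩ := johnson_aux m k hm
    exact ⟨A, hA, h, johnson_aux_count m k A hA h⟩
  · intro n
    obtain ⟨A, hA, h⟩ := johnson_aux (2 * n + 1) n (by omega)
    exact ⟨2 * n + 1, n, by omega, A, hA, johnson_aux_count _ n A hA h⟩
end

section
/- For all natural numbers d and q, the VC-dimension of the edge relation on the Hamming graph H(d,q) is at most 3; that is, no set of 4 vertices of H(d,q) is shattered by the edge relation. -/
open SimpleGraph

/-- The Hamming graph `H(d,q)`. -/
def hammingGraph (d q : ℕ) : SimpleGraph (Fin d → Fin q) where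
  Adj u v := hammingDist u v = 1
  symm := by
    refine ⟨?_⟩
    intro u v h
    rwa [hammingDist_comm]
  loopless := by
    refine ⟨?_⟩
    intro u h
    simp [hammingDist_self] at h

/-- The VC-dimension of the edge relation of `G`. -/
noncomputable def edgeVCDim {V : Type*} (G : SimpleGraph V) : ℕ :=
  sSup {n | ∃ A : Finset V, A.card = n ∧ edgeShatters G ↑A}

/-- `u` and `v` differ exactly at `i`. -/
def DiffAt {d q : ℕ} (i : Fin d) (u v : Fin d → Fin q) : Prop :=
  u i ≠ v i ∧ ∀ j, j ≠ i → u j = v j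

lemma hg_adj_iff {d q : ℕ} (u v : Fin d → Fin q) :
    (hammingGraph d q).Adj u v ↔ ∃ i, DiffAt i u v := by
  change hammingDist u v = 1 ↔ _
  unfold hammingDist DiffAt
  rw [Finset.card_eq_one]
  constructor
  · rintro ⟨i, hi⟩
    have h : ∀ j, u j ≠ v j ↔ j = i := by
      intro j
      have := congrArg (fun s => j ∈ s) hi
      simpa using this
    refine ⟨i, (h i).2 rfl, fun j hj => ?_⟩
    by_contra hne
    exact hj ((h j).1 hne)
  · rintro ⟨i, h1, h2⟩
    refine ⟨i, ?_⟩
    ext j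
    simp only [Finset.mem_filter, Finset.mem_univ, true_and, Finset.mem_singleton]
    constructor
    · intro h
      by_contra hj
      exact h (h2 j hj)
    · rintro rfl
      exact h1

lemma pair1 {d q : ℕ} {w w' a b : Fin d → Fin q} {i j p r : Fin d}
    (ha : DiffAt i w a) (hb : DiffAt j w b) (hpa : DiffAt p w' a) (hrb : DiffAt r w' b)
    (hw : w' ≠ w) (hij : i ≠ j) : w' i = a i := by
  by_contra hne
  apply hw
  obtain ⟨ha1, ha2⟩ := ha
  obtain ⟨hb1, hb2⟩ := hb
  obtain ⟨hp1, hp2⟩ := hpa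
  obtain ⟨hr1, hr2⟩ := hrb
  have e1 : p = i := by
    by_contra h
    exact hne (hp2 i (Ne.symm h))
  subst e1
  have e2 : r = j := by
    by_contra h
    have := hr2 j (Ne.symm h)
    have := hp2 j hij.symm
    have := ha2 j hij.symm
    grind
  subst e2
  funext k
  by_cases hk : k = p
  · subst hk
    rw [hr2 k hij, hb2 k hij]
  · rw [hp2 k hk, ha2 k hk]

lemma triple1 {d q : ℕ} {w w' a b c : Fin d → Fin q} {i j k p r s : Fin d}
    (ha : DiffAt i w a) (hb : DiffAt j w b) (hc : DiffAt k w c)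
    (hpa : DiffAt p w' a) (hrb : DiffAt r w' b) (hsc : DiffAt s w' c)
    (hw : w' ≠ w) (hac : a ≠ c) (hbc : b ≠ c) : i = j := by
  by_contra hij
  have h1 := pair1 ha hb hpa hrb hw hij
  have h2 := pair1 hb ha hrb hpa hw (Ne.symm hij)
  obtain ⟨ha1, ha2⟩ := ha
  obtain ⟨hb1, hb2⟩ := hb
  obtain ⟨hc1, hc2⟩ := hc
  obtain ⟨hs1, hs2⟩ := hsc
  by_cases hki : k = i
  · subst hki
    apply hac
    funext t
    by_cases ht : t = k
    · subst ht
      grind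
    · rw [← ha2 t ht, ← hc2 t ht]
  · by_cases hkj : k = j
    · subst hkj
      apply hbc
      funext t
      by_cases ht : t = k
      · subst ht
        grind
      · rw [← hb2 t ht, ← hc2 t ht]
    · grind

lemma line1 {d q : ℕ} {w u a b c : Fin d → Fin q} {i p r : Fin d}
    (ha : DiffAt i w a) (hb : DiffAt i w b) (hc : DiffAt i w c)
    (hpa : DiffAt p u a) (hrb : DiffAt r u b) (hab : a ≠ b)
    (hn : ¬ ∃ s, DiffAt s u c) : u = c := by
  obtain ⟨ha1, ha2⟩ := ha
  obtain ⟨hb1, hb2⟩ := hb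
  obtain ⟨hc1, hc2⟩ := hc
  obtain ⟨hp1, hp2⟩ := hpa
  obtain ⟨hr1, hr2⟩ := hrb
  have hi : a i ≠ b i := by
    intro h
    apply hab
    funext t
    by_cases ht : t = i
    · rw [ht, h]
    · rw [← ha2 t ht, ← hb2 t ht]
  have hoff : ∀ t, t ≠ i → u t = w t := by
    intro t ht
    grind
  by_contra hne
  apply hn
  refine ⟨i, ?_, fun t ht => by rw [hoff t ht, hc2 t ht]⟩
  intro h
  apply hne
  funext t
  by_cases ht : t = i
  · rw [ht, h]
  · rw [hoff t ht, hc2 t ht]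

lemma no_four {d q : ℕ} (A : Finset (Fin d → Fin q)) (hA : 4 ≤ A.card) :
    ¬ edgeShatters (hammingGraph d q) ↑A := by
  intro hS
  obtain ⟨T, hTA, hT⟩ := Finset.exists_subset_card_eq hA
  obtain ⟨a, b, c, e, hab, hac, hae, hbc, hbe, hce, rfl⟩ := Finset.card_eq_four.1 hT
  have key : ∀ B : Set (Fin d → Fin q), B ⊆ ↑A →
      ∃ w, ∀ x ∈ A, (∃ i, DiffAt i w x) ↔ x ∈ B := by
    intro B hB
    obtain ⟨w, hw⟩ := hS B hB
    refine ⟨w, fun x hx => ?_⟩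
    rw [← hw, ← hg_adj_iff]
    simp [hx]
  have ma : a ∈ A := hTA (by simp)
  have mb : b ∈ A := hTA (by simp)
  have mc : c ∈ A := hTA (by simp)
  have me : e ∈ A := hTA (by simp)
  obtain ⟨w, hw⟩ := key {a, b, c, e} (by intro x; simp; grind)
  obtain ⟨v, hv⟩ := key {a, b, c} (by intro x; simp; grind)
  obtain ⟨v', hv'⟩ := key {a, b, e} (by intro x; simp; grind)
  obtain ⟨u, hu⟩ := key {a, b} (by intro x; simp; grind)
  obtain ⟨i, wa⟩ := (hw a ma).2 (by simp)
  obtain ⟨j, wb⟩ := (hw b mb).2 (by simp)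
  obtain ⟨k, wc⟩ := (hw c mc).2 (by simp)
  obtain ⟨l, we⟩ := (hw e me).2 (by simp)
  obtain ⟨_, va⟩ := (hv a ma).2 (by simp)
  obtain ⟨_, vb⟩ := (hv b mb).2 (by simp)
  obtain ⟨_, vc⟩ := (hv c mc).2 (by simp)
  obtain ⟨_, va'⟩ := (hv' a ma).2 (by simp)
  obtain ⟨_, vb'⟩ := (hv' b mb).2 (by simp)
  obtain ⟨_, ve'⟩ := (hv' e me).2 (by simp)
  obtain ⟨_, ua⟩ := (hu a ma).2 (by simp)
  obtain ⟨_, ub⟩ := (hu b mb).2 (by simp)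
  have hvw : v ≠ w := by
    rintro rfl
    have := (hv e me).1 ⟨_, we⟩
    simp at this
    grind
  have hvw' : v' ≠ w := by
    rintro rfl
    have := (hv' c mc).1 ⟨_, wc⟩
    simp at this
    grind
  have e1 : i = j := triple1 wa wb wc va vb vc hvw hac hbc
  have e2 : i = k := triple1 wa wc wb va vc vb hvw hab hbc.symm
  have e3 : i = l := triple1 wa we wb va' ve' vb' hvw' hab hbe.symm
  subst e1 e2 e3
  have h1 : u = c := line1 wa wb wc ua ub hab (by
    rw [hu c mc]; simp; grind)
  have h2 : u = e := line1 wa wb we ua ub hab (by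
    rw [hu e me]; simp; grind)
  exact hce (h1.symm.trans h2)

/-- The VC-dimension of the edge relation of a Hamming graph is at most `3`:
no set of `4` vertices is shattered. -/
theorem hamming_vc_dim_le_three (d q : ℕ) :
    edgeVCDim (hammingGraph d q) ≤ 3 ∧
      ∀ A : Finset (Fin d → Fin q), A.card = 4 →
        ¬ edgeShatters (hammingGraph d q) ↑A := by
  refine ⟨?_, fun A hA => no_four A hA.ge⟩
  unfold edgeVCDim
  apply csSup_le'
  rintro n ⟨A, rfl, hS⟩
  by_contra h
  exact no_four A (by omega) hS
end
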